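/- Let N ≥ 2, p > N/2 and M > 0. Then there exists ε = ε(N,p,M) > 0 with the following property: for every radial a ∈ L^p(B_1) satisfying ‖a‖_{L^p(B_1)} ≤ M and every nontrivial radial H^1 solution u of Δu + a u = 0 in B_1, any two distinct zeros z_1, z_2 ∈ (0,1] of u satisfy |z_2 − z_1| > ε. -/

import Mathlib

open MeasureTheory Set Filter

noncomputable section

/-- The measure of the (N-1)-dimensional unit sphere in `ℝ^N`. -/
def omegaN (N : ℕ) : ℝ :=
  N * (volume (Metric.ball (0 : EuclideanSpace ℝ (Fin N)) 1)).toReal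

/-- `u` is a radial Neumann solution of `Δu + a u = 0` on the unit ball of `ℝ^N`,
with explicit derivative function `u'` : `u` is continuous on `[0,1]`, differentiable on
`(0,1]`, satisfies the integrated radial equation
`r^(N-1) u'(r) = -∫_0^r s^(N-1) a(s) u(s) ds` on `(0,1]`, and `u'(1) = 0`. -/
def IsRadialNeumannSolutionDeriv (N : ℕ) (a u u' : ℝ → ℝ) : Prop :=
  ContinuousOn u (Icc 0 1) ∧
  (∀ r ∈ Ioc (0:ℝ) 1, HasDerivAt u (u' r) r) ∧
  (∀ r ∈ Ioc (0:ℝ) 1,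
    r ^ (N - 1) * u' r = - ∫ s in (0:ℝ)..r, s ^ (N - 1) * a s * u s) ∧
  u' 1 = 0

/-- `u` is a radial Neumann solution of `Δu + a u = 0` on the unit ball of `ℝ^N`. -/
def IsRadialNeumannSolution (N : ℕ) (a u : ℝ → ℝ) : Prop :=
  ∃ u' : ℝ → ℝ, IsRadialNeumannSolutionDeriv N a u u'

/-- `u` is not identically zero on `[0,1]`. -/
def NontrivialSol (u : ℝ → ℝ) : Prop := ∃ r ∈ Icc (0:ℝ) 1, u r ≠ 0

/-- `μ ≺ a` : `a(r) ≥ μ` for a.e. `r ∈ (0,1)` and `a(r) > μ` on a set of positive measure. -/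
def Prec (μ : ℝ) (a : ℝ → ℝ) : Prop :=
  (∀ᵐ r ∂(volume.restrict (Ioo (0:ℝ) 1)), μ ≤ a r) ∧
  0 < volume {r ∈ Ioo (0:ℝ) 1 | μ < a r}

/-- A radial function `a` belongs to `L^p(B_1)` (finite `p`). -/
def RadialMemLp (N : ℕ) (p : ℝ) (a : ℝ → ℝ) : Prop :=
  IntegrableOn (fun r => r ^ (N - 1) * |a r| ^ p) (Ioo (0:ℝ) 1)

/-- A radial function `a` belongs to `L^∞(B_1)`. -/
def RadialMemLinfty (a : ℝ → ℝ) : Prop :=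
  ∃ C : ℝ, ∀ᵐ r ∂(volume.restrict (Ioo (0:ℝ) 1)), |a r| ≤ C

/-- The `L^p(B_1)` norm of a radial function (finite `p`):
`(ω_N ∫_0^1 r^(N-1) |a(r)|^p dr)^(1/p)`. -/
def radialLpNorm (N : ℕ) (p : ℝ) (a : ℝ → ℝ) : ℝ :=
  (omegaN N * ∫ r in (0:ℝ)..1, r ^ (N - 1) * |a r| ^ p) ^ (1 / p)

/-- The `L^∞(B_1)` norm of a radial function: essential supremum of `|a|` on `(0,1)`. -/
def radialLinftyNorm (a : ℝ → ℝ) : ℝ :=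
  essSup (fun r => |a r|) (volume.restrict (Ioo (0:ℝ) 1))

/-- The admissible class `Γ_k` at level `μk`: radial measurable `a` with `μk ≺ a`, such that
`Δu + a u = 0` has a nontrivial radial Neumann solution, and `a ∈ L^{N/2}(B_1)` if `N ≥ 3`,
or `a ∈ L^q(B_1)` for some `q ∈ (1,∞]` if `N = 2`. -/
def GammaSet (N : ℕ) (μk : ℝ) (a : ℝ → ℝ) : Prop :=
  Measurable a ∧ Prec μk a ∧
  (∃ u : ℝ → ℝ, IsRadialNeumannSolution N a u ∧ NontrivialSol u) ∧
  (if 3 ≤ N then RadialMemLp N ((N : ℝ) / 2) a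
   else (∃ q : ℝ, 1 < q ∧ RadialMemLp N q a) ∨ RadialMemLinfty a)

/-- The Lyapunov constant `γ_{p,k}` for finite `p`. -/
def gammaLyap (N : ℕ) (μk : ℝ) (p : ℝ) : ℝ :=
  sInf {t : ℝ | ∃ a : ℝ → ℝ, GammaSet N μk a ∧ RadialMemLp N p a ∧
    t = radialLpNorm N p (fun r => a r - μk)}

/-- The Lyapunov constant `γ_{∞,k}`. -/
def gammaLyapInfty (N : ℕ) (μk : ℝ) : ℝ :=
  sInf {t : ℝ | ∃ a : ℝ → ℝ, GammaSet N μk a ∧ RadialMemLinfty a ∧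
    t = radialLinftyNorm (fun r => a r - μk)}

/-- `(μ, φ)` is the `k`-th radial Neumann eigenpair of `-Δ` on `B_1 ⊆ ℝ^N`:
`μ ≥ 0`, `φ` is a nontrivial radial Neumann solution of `Δφ + μ φ = 0` having exactly `k`
zeros in `(0,1)`, all simple, given by `rz k < rz (k-1) < ⋯ < rz 1`. -/
def IsRadialNeumannEigenpair (N k : ℕ) (μ : ℝ) (φ : ℝ → ℝ) (rz : ℕ → ℝ) : Prop :=
  0 ≤ μ ∧
  IsRadialNeumannSolution N (fun _ => μ) φ ∧ NontrivialSol φ ∧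
  (∀ i, 1 ≤ i → i ≤ k → rz i ∈ Ioo (0:ℝ) 1) ∧
  (∀ i j, 1 ≤ i → i < j → j ≤ k → rz j < rz i) ∧
  (∀ x ∈ Ioo (0:ℝ) 1, (φ x = 0 ↔ ∃ i, 1 ≤ i ∧ i ≤ k ∧ x = rz i)) ∧
  (∀ i, 1 ≤ i → i ≤ k → ∃ d : ℝ, d ≠ 0 ∧ HasDerivAt φ d (rz i))

/-- `u` (with derivative `u'`) is a radial `H^1` solution of `Δu + a u = 0` in `B_1`:
continuous on `(0,1]`, differentiable on `(0,1)`, satisfying the integrated radial equation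
between any two radii, with finite radial `H^1` energy. -/
def IsRadialH1Solution (N : ℕ) (a u u' : ℝ → ℝ) : Prop :=
  ContinuousOn u (Ioc 0 1) ∧
  (∀ r ∈ Ioo (0:ℝ) 1, HasDerivAt u (u' r) r) ∧
  (∀ s ∈ Ioo (0:ℝ) 1, ∀ r ∈ Ioo (0:ℝ) 1, s < r →
    r ^ (N - 1) * u' r - s ^ (N - 1) * u' s
      = - ∫ t in s..r, t ^ (N - 1) * a t * u t) ∧
  IntegrableOn (fun r => r ^ (N - 1) * ((u' r) ^ 2 + (u r) ^ 2)) (Ioo (0:ℝ) 1)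

/-- The Sobolev quotient: infimum of `(∫_{B_ρ} |∇w|²) / (∫_{B_ρ} |w|^q)^{2/q}` over nontrivial
`C^1` functions `w : ℝ^N → ℝ` with compact support contained in the ball `B_ρ`. -/
def sobolevQuot (N : ℕ) (q : ℝ) (ρ : ℝ) : ℝ :=
  sInf {t : ℝ | ∃ w : EuclideanSpace ℝ (Fin N) → ℝ,
    ContDiff ℝ 1 w ∧ (∃ x, w x ≠ 0) ∧ tsupport w ⊆ Metric.ball 0 ρ ∧
    t = (∫ x in Metric.ball (0 : EuclideanSpace ℝ (Fin N)) ρ, ‖fderiv ℝ w x‖ ^ 2) /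
        (∫ x in Metric.ball (0 : EuclideanSpace ℝ (Fin N)) ρ, |w x| ^ q) ^ (2 / q)}

lemma le_add_rpow_mul_rpow {p x l : ℝ} (hp : 1 < p) (hx : 0 ≤ x) (hl : 0 < l) :
    x ≤ l + l ^ (1 - p) * x ^ p := by
  rcases le_or_gt x l with h | h
  · have : 0 ≤ l ^ (1 - p) * x ^ p := by positivity
    linarith
  · have hx0 : 0 < x := hl.trans h
    have h1 : x ^ p = x ^ (p - 1) * x := by
      rw [Real.rpow_sub_one hx0.ne']
      field_simp
    have h2 : l ^ (1 - p) * l ^ (p - 1) = 1 := by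
      rw [← Real.rpow_add hl]
      simp
    have h3 : l ^ (p - 1) ≤ x ^ (p - 1) := Real.rpow_le_rpow hl.le h.le (by linarith)
    have h4 : 0 < l ^ (1 - p) := by positivity
    have h5 : 1 ≤ l ^ (1 - p) * x ^ (p - 1) := by
      calc 1 = l ^ (1 - p) * l ^ (p - 1) := h2.symm
        _ ≤ _ := by gcongr
    rw [h1]
    nlinarith

lemma omegaN_pos {N : ℕ} (hN : 0 < N) : 0 < omegaN N := by
  unfold omegaN
  have h : 0 < (volume (Metric.ball (0 : EuclideanSpace ℝ (Fin N)) 1)).toReal :=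
    ENNReal.toReal_pos (Metric.measure_ball_pos _ _ one_pos).ne' measure_ball_lt_top.ne
  positivity

lemma integral_rpow_nonneg (N : ℕ) (p : ℝ) (a : ℝ → ℝ) :
    0 ≤ ∫ r in (0:ℝ)..1, r ^ (N - 1) * |a r| ^ p := by
  refine intervalIntegral.integral_nonneg zero_le_one fun t ht => ?_
  have := ht.1
  positivity

/-- A bound on the radial norm bounds the weighted integral of `|a| ^ p`. -/
lemma integral_rpow_le_of_radialLpNorm_le {N : ℕ} {p M : ℝ} {a : ℝ → ℝ} (hN : 0 < N) (hp : 0 < p)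
    (h : radialLpNorm N p a ≤ M) :
    ∫ r in (0:ℝ)..1, r ^ (N - 1) * |a r| ^ p ≤ M ^ p / omegaN N := by
  have hω := omegaN_pos hN
  have h0 : 0 ≤ omegaN N * ∫ r in (0:ℝ)..1, r ^ (N - 1) * |a r| ^ p :=
    mul_nonneg hω.le (integral_rpow_nonneg N p a)
  rw [le_div_iff₀' hω]
  have h1 := Real.rpow_le_rpow (Real.rpow_nonneg h0 _) h hp.le
  rwa [← Real.rpow_mul h0, one_div_mul_cancel hp.ne', Real.rpow_one] at h1

lemma RadialMemLp.integrableOn_mul_abs {N : ℕ} {p : ℝ} {a : ℝ → ℝ} (hp : 1 < p)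
    (ha : Measurable a) (h : RadialMemLp N p a) :
    IntegrableOn (fun t => t ^ (N - 1) * |a t|) (Ioo (0:ℝ) 1) := by
  have h1 : IntegrableOn (fun t : ℝ => t ^ (N - 1)) (Ioo (0:ℝ) 1) :=
    ((continuous_pow _).continuousOn.integrableOn_Icc (a := (0:ℝ)) (b := 1)).mono_set
      Ioo_subset_Icc_self
  refine Integrable.mono' (h1.add h) (by fun_prop) ?_
  filter_upwards [ae_restrict_mem measurableSet_Ioo] with t ht
  have ht0 := ht.1
  rw [Real.norm_of_nonneg (by positivity)]
  have h2 := le_add_rpow_mul_rpow hp (abs_nonneg (a t)) one_pos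
  rw [Real.one_rpow, one_mul] at h2
  calc t ^ (N - 1) * |a t| ≤ t ^ (N - 1) * (1 + |a t| ^ p) := by gcongr
    _ = _ := by simp only [Pi.add_apply]; ring

lemma IntegrableOn.intervalIntegrable_of_mem_Icc {f : ℝ → ℝ} (h : IntegrableOn f (Ioo (0:ℝ) 1))
    {s r : ℝ} (hs : 0 ≤ s) (hsr : s ≤ r) (hr : r ≤ 1) : IntervalIntegrable f volume s r := by
  rw [intervalIntegrable_iff_integrableOn_Ioo_of_le hsr]
  exact h.mono_set (Ioo_subset_Ioo hs hr)

lemma integral_mono_Icc {f : ℝ → ℝ} (h : IntegrableOn f (Ioo (0:ℝ) 1))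
    (hf : ∀ t, 0 ≤ t → 0 ≤ f t) {s r : ℝ} (hs : 0 ≤ s) (hsr : s ≤ r) (hr : r ≤ 1) :
    ∫ t in s..r, f t ≤ ∫ t in (0:ℝ)..1, f t := by
  refine intervalIntegral.integral_mono_interval hs hsr hr ?_
    (IntegrableOn.intervalIntegrable_of_mem_Icc h le_rfl zero_le_one le_rfl)
  filter_upwards [ae_restrict_mem measurableSet_Ioc] with t ht using hf t ht.1.le

/-- The flux `r ^ (N - 1) * u' r` varies by at most `m ∫ t ^ (N - 1) |a|` where `|u| ≤ m`. -/
lemma IsRadialH1Solution.abs_flux_sub_le {N : ℕ} {a u u' : ℝ → ℝ} (h : IsRadialH1Solution N a u u')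
    (ha : IntegrableOn (fun t => t ^ (N - 1) * |a t|) (Ioo (0:ℝ) 1)) {s r m : ℝ}
    (hs : s ∈ Ioo (0:ℝ) 1) (hr : r ∈ Ioo (0:ℝ) 1) (hsr : s ≤ r)
    (hm : ∀ t ∈ Icc s r, |u t| ≤ m) :
    |r ^ (N - 1) * u' r - s ^ (N - 1) * u' s| ≤ m * ∫ t in s..r, t ^ (N - 1) * |a t| := by
  rcases hsr.eq_or_lt with rfl | hlt
  · simp
  rw [h.2.2.1 s hs r hr hlt, abs_neg, ← intervalIntegral.integral_const_mul, ← Real.norm_eq_abs]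
  refine intervalIntegral.norm_integral_le_of_norm_le hsr (Eventually.of_forall fun t ht => ?_)
    ((IntegrableOn.intervalIntegrable_of_mem_Icc ha hs.1.le hsr hr.2.le).const_mul m)
  have ht0 : 0 < t := hs.1.trans ht.1
  rw [Real.norm_eq_abs, abs_mul, abs_mul, abs_of_pos (pow_pos ht0 _), mul_comm]
  gcongr
  exact hm t (Ioc_subset_Icc_self ht)

/-- Vanishing Cauchy data propagate locally, in both directions. -/
lemma IsRadialH1Solution.exists_cauchy_zero_nhds {N : ℕ} {a u u' : ℝ → ℝ}
    (h : IsRadialH1Solution N a u u')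
    (ha : IntegrableOn (fun t => t ^ (N - 1) * |a t|) (Ioo (0:ℝ) 1)) {c : ℝ}
    (hc : c ∈ Ioo (0:ℝ) 1) :
    ∃ δ > 0, ∀ x ∈ Icc (c - δ) (c + δ), u x = 0 ∧ u' x = 0 →
      ∀ y ∈ Icc (c - δ) (c + δ), u y = 0 ∧ u' y = 0 := by
  obtain ⟨hc0, hc1⟩ := hc
  set B := ∫ t in (0:ℝ)..1, t ^ (N - 1) * |a t| with hB
  have hB0 : 0 ≤ B := by
    refine intervalIntegral.integral_nonneg zero_le_one fun t ht => ?_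
    have := ht.1
    positivity
  set l := (c / 2) ^ (N - 1) with hl
  have hl0 : 0 < l := by positivity
  set δ := min (min (c / 2) ((1 - c) / 2)) (l / (4 * (B + 1))) with hδ
  have hδ0 : 0 < δ := lt_min (lt_min (by linarith) (by linarith)) (by positivity)
  have hδ1 : δ ≤ c / 2 := (min_le_left _ _).trans (min_le_left _ _)
  have hδ2 : δ ≤ (1 - c) / 2 := (min_le_left _ _).trans (min_le_right _ _)
  have hδ3 : δ * (4 * (B + 1)) ≤ l := by
    rw [← le_div_iff₀ (by positivity)]
    exact min_le_right _ _
  refine ⟨δ, hδ0, fun x hx hux y hy => ?_⟩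
  have hJ : Icc (c - δ) (c + δ) ⊆ Ioo (0:ℝ) 1 := fun t ht =>
    ⟨by linarith [ht.1], by linarith [ht.2]⟩
  have hcont : ContinuousOn (fun t => |u t|) (Icc (c - δ) (c + δ)) :=
    (h.1.mono (hJ.trans Ioo_subset_Ioc_self)).abs
  obtain ⟨w, hw, hmax⟩ := isCompact_Icc.exists_isMaxOn ⟨x, hx⟩ hcont
  set m := |u w| with hm
  have hm0 : 0 ≤ m := abs_nonneg _
  have hle : ∀ t ∈ Icc (c - δ) (c + δ), |u t| ≤ m := fun t ht => hmax ht
  have hder : ∀ t ∈ Icc (c - δ) (c + δ), l * |u' t| ≤ m * B := by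
    intro t ht
    have ht0 := hJ ht
    have hx0 := hJ hx
    have hlt : l ≤ t ^ (N - 1) := by
      rw [hl]
      gcongr
      linarith [ht.1]
    have hflux : |t ^ (N - 1) * u' t| ≤ m * B := by
      rcases le_total x t with hxt | hxt
      · have h1 := h.abs_flux_sub_le ha hx0 ht0 hxt
          (fun s hs => hle s ⟨hx.1.trans hs.1, hs.2.trans ht.2⟩)
        rw [hux.2, mul_zero, sub_zero] at h1
        refine h1.trans ?_
        gcongr
        exact integral_mono_Icc ha (fun t ht => by positivity) hx0.1.le hxt ht0.2.le
      · have h1 := h.abs_flux_sub_le ha ht0 hx0 hxt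
          (fun s hs => hle s ⟨ht.1.trans hs.1, hs.2.trans hx.2⟩)
        rw [hux.2, mul_zero, zero_sub, abs_neg] at h1
        refine h1.trans ?_
        gcongr
        exact integral_mono_Icc ha (fun t ht => by positivity) ht0.1.le hxt hx0.2.le
    rw [abs_mul, abs_of_pos (pow_pos ht0.1 _)] at hflux
    exact (by gcongr : l * |u' t| ≤ t ^ (N - 1) * |u' t|).trans hflux
  have hmv := (convex_Icc (c - δ) (c + δ)).norm_image_sub_le_of_norm_hasDerivWithin_le
    (f := u) (f' := u') (C := m * B / l) (x := x) (y := w)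
    (fun t ht => (h.2.1 t (hJ ht)).hasDerivWithinAt)
    (fun t ht => by rw [Real.norm_eq_abs, le_div_iff₀' hl0]; exact hder t ht) hx hw
  rw [hux.1, sub_zero, Real.norm_eq_abs, Real.norm_eq_abs] at hmv
  have hdist : |w - x| ≤ 2 * δ := by
    rw [abs_le]
    constructor <;> linarith [hx.1, hx.2, hw.1, hw.2]
  have hmle : m ≤ m * B / l * (2 * δ) := hmv.trans (by gcongr)
  have hmz : m = 0 := by
    rw [div_mul_eq_mul_div, le_div_iff₀ hl0] at hmle
    by_contra hne
    have hpos : 0 < m := lt_of_le_of_ne hm0 (Ne.symm hne)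
    have : l ≤ B * (2 * δ) := by
      refine le_of_mul_le_mul_left ?_ hpos
      linarith
    nlinarith
  refine ⟨abs_nonpos_iff.1 (hmz ▸ hle y hy), ?_⟩
  have h1 := hder y hy
  rw [hmz, zero_mul] at h1
  exact abs_nonpos_iff.1 (nonpos_of_mul_nonpos_right h1 hl0)

/-- Unique continuation: vanishing Cauchy data at one radius force `u = 0`. -/
lemma IsRadialH1Solution.eq_zero_of_cauchy_zero {N : ℕ} {a u u' : ℝ → ℝ}
    (h : IsRadialH1Solution N a u u')
    (ha : IntegrableOn (fun t => t ^ (N - 1) * |a t|) (Ioo (0:ℝ) 1)) {c : ℝ}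
    (hc : c ∈ Ioo (0:ℝ) 1) (hu : u c = 0) (hu' : u' c = 0) : ∀ r ∈ Ioc (0:ℝ) 1, u r = 0 := by
  have hIoo : ∀ r ∈ Ioo (0:ℝ) 1, u r = 0 := by
    intro r hr
    have key := isPreconnected_Ioo.induction₂ (s := Ioo (0:ℝ) 1)
      (fun x y => (u x = 0 ∧ u' x = 0) ↔ (u y = 0 ∧ u' y = 0))
      (fun x hx => ?_) (fun x y z _ _ _ => Iff.trans) (fun x y _ _ => Iff.symm) hc hr
    · exact (key.1 ⟨hu, hu'⟩).1
    · obtain ⟨δ, hδ, H⟩ := h.exists_cauchy_zero_nhds ha hx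
      have hxm : x ∈ Icc (x - δ) (x + δ) := ⟨by linarith, by linarith⟩
      filter_upwards [mem_nhdsWithin_of_mem_nhds
        (Icc_mem_nhds (by linarith : x - δ < x) (by linarith : x < x + δ))] with y hy
      exact ⟨fun h0 => H x hxm h0 y hy, fun h0 => H y hy h0 x hxm⟩
  intro r hr
  rcases hr.2.eq_or_lt with rfl | hlt
  · have hcl : (1:ℝ) ∈ closure (Ioo (0:ℝ) 1) := by
      rw [closure_Ioo zero_ne_one]
      exact ⟨zero_le_one, le_rfl⟩
    have : (nhdsWithin (1:ℝ) (Ioo 0 1)).NeBot := mem_closure_iff_nhdsWithin_neBot.1 hcl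
    refine tendsto_nhds_unique ((h.1 1 hr).mono_left (nhdsWithin_mono _ Ioo_subset_Ioc_self)) ?_
    refine tendsto_const_nhds.congr' ?_
    filter_upwards [self_mem_nhdsWithin] with t ht using (hIoo t ht).symm
  · exact hIoo r ⟨hr.1, hlt⟩

/-- Averages of `|a|` over `(c, r)` with weight `(t / r) ^ (N - 1)`, in terms of an `L^p` bound. -/
lemma integral_mul_abs_le {N : ℕ} (hN : 0 < N) {p K : ℝ} {a : ℝ → ℝ} (hp : 1 < p)
    (ha : Measurable a) (h : RadialMemLp N p a)
    (hK : ∫ r in (0:ℝ)..1, r ^ (N - 1) * |a r| ^ p ≤ K) {c r : ℝ}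
    (hc : 0 < c) (hcr : c < r) (hr : r ≤ 1) :
    ∫ t in c..r, t ^ (N - 1) * |a t| ≤
      r ^ (N - 1) * ((1 + K) * (r - c) ^ (1 - (N : ℝ) / p)) := by
  have hs : 0 < r - c := sub_pos.2 hcr
  have hr0 : 0 < r := hc.trans hcr
  have hp0 : 0 < p := by linarith
  have hK0 : 0 ≤ K := (integral_rpow_nonneg N p a).trans hK
  set l := (r - c) ^ (-((N : ℝ) / p)) with hl
  have hl0 : 0 < l := by positivity
  have hnonneg : ∀ t : ℝ, 0 ≤ t → 0 ≤ t ^ (N - 1) * |a t| ^ p := fun t ht => by positivity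
  have h_integrable := IntegrableOn.intervalIntegrable_of_mem_Icc h hc.le hcr.le hr
  have h1 : ∫ t in c..r, t ^ (N - 1) * |a t| ≤
      ∫ t in c..r, (r ^ (N - 1) * l + l ^ (1 - p) * (t ^ (N - 1) * |a t| ^ p)) := by
    refine intervalIntegral.integral_mono_on hcr.le
      (IntegrableOn.intervalIntegrable_of_mem_Icc (h.integrableOn_mul_abs hp ha) hc.le hcr.le hr)
      (intervalIntegrable_const.add (h_integrable.const_mul _)) fun t ht => ?_
    have ht0 : 0 < t := hc.trans_le ht.1
    calc t ^ (N - 1) * |a t| ≤ t ^ (N - 1) * (l + l ^ (1 - p) * |a t| ^ p) := by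
          gcongr
          exact le_add_rpow_mul_rpow hp (abs_nonneg _) hl0
      _ = t ^ (N - 1) * l + l ^ (1 - p) * (t ^ (N - 1) * |a t| ^ p) := by ring
      _ ≤ _ := by
          gcongr
          exact ht.2
  rw [intervalIntegral.integral_add intervalIntegrable_const (h_integrable.const_mul _),
    intervalIntegral.integral_const, intervalIntegral.integral_const_mul, smul_eq_mul] at h1
  have h2 : ∫ t in c..r, t ^ (N - 1) * |a t| ^ p ≤ K :=
    (integral_mono_Icc h hnonneg hc.le hcr.le hr).trans hK
  have h3 : (r - c) * l = (r - c) ^ (1 - (N : ℝ) / p) := by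
    rw [hl, sub_eq_add_neg 1, Real.rpow_add hs, Real.rpow_one]
  have h4 : l ^ (1 - p) = (r - c) ^ (N - 1) * (r - c) ^ (1 - (N : ℝ) / p) := by
    rw [hl, ← Real.rpow_mul hs.le, ← Real.rpow_natCast, ← Real.rpow_add hs, Nat.cast_pred hN]
    congr 1
    field_simp
    ring
  have h5 : (r - c) ^ (N - 1) ≤ r ^ (N - 1) := by
    gcongr
    linarith
  calc _ ≤ _ := h1
    _ = r ^ (N - 1) * (r - c) ^ (1 - (N : ℝ) / p) +
        l ^ (1 - p) * ∫ t in c..r, t ^ (N - 1) * |a t| ^ p := by rw [← h3]; ring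
    _ ≤ r ^ (N - 1) * (r - c) ^ (1 - (N : ℝ) / p) +
        (r ^ (N - 1) * (r - c) ^ (1 - (N : ℝ) / p)) * K := by
        rw [h4]
        have : 0 ≤ ∫ t in c..r, t ^ (N - 1) * |a t| ^ p :=
          intervalIntegral.integral_nonneg hcr.le fun t ht => hnonneg t (hc.le.trans ht.1)
        gcongr
    _ = _ := by ring

/-- A lower bound for the distance from a critical point where `|u|` is maximal to the next zero. -/
lemma IsRadialH1Solution.le_mul_rpow_of_critical {N : ℕ} (hN : 0 < N) {p K : ℝ} {a u u' : ℝ → ℝ}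
    (hp : 1 < p) (hNp : (N : ℝ) / 2 < p) (h : IsRadialH1Solution N a u u') (ha : Measurable a)
    (hap : RadialMemLp N p a) (hK : ∫ r in (0:ℝ)..1, r ^ (N - 1) * |a r| ^ p ≤ K) {c z : ℝ}
    (hc : 0 < c) (hcz : c < z) (hz : z ≤ 1) (huc : u c ≠ 0) (huc' : u' c = 0) (huz : u z = 0)
    (hmax : ∀ t ∈ Icc c z, |u t| ≤ |u c|) :
    2 - (N : ℝ) / p ≤ (1 + K) * (z - c) ^ (2 - (N : ℝ) / p) := by
  have hp0 : 0 < p := by linarith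
  set α := 2 - (N : ℝ) / p with hα
  have hα0 : 0 < α := by
    rw [hα, sub_pos, div_lt_iff₀ hp0]
    linarith
  set m := |u c| with hm
  have hm0 : 0 < m := abs_pos.2 huc
  have hder : ∀ r ∈ Ioo c z, |u' r| ≤ m * ((1 + K) * (r - c) ^ (α - 1)) := by
    intro r hr
    have hr0 : 0 < r := hc.trans hr.1
    have hrn : 0 < r ^ (N - 1) := by positivity
    have h1 := h.abs_flux_sub_le (hap.integrableOn_mul_abs hp ha)
      ⟨hc, hcz.trans_le hz⟩ ⟨hr0, hr.2.trans_le hz⟩ hr.1.le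
      (fun t ht => hmax t ⟨ht.1, ht.2.trans hr.2.le⟩)
    rw [huc', mul_zero, sub_zero, abs_mul, abs_of_pos hrn] at h1
    have h2 := integral_mul_abs_le hN hp ha hap hK hc hr.1 (hr.2.le.trans hz)
    have h3 : 1 - (N : ℝ) / p = α - 1 := by rw [hα]; ring
    rw [h3] at h2
    refine le_of_mul_le_mul_left ?_ hrn
    calc _ ≤ _ := h1
      _ ≤ m * (r ^ (N - 1) * ((1 + K) * (r - c) ^ (α - 1))) := by gcongr
      _ = _ := by ring
  have hmono : MonotoneOn
      (fun r => u c * u r + m ^ 2 * (1 + K) / α * (r - c) ^ α) (Icc c z) := by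
    refine monotoneOn_of_hasDerivWithinAt_nonneg (convex_Icc c z)
      (f' := fun r => u c * u' r + m ^ 2 * (1 + K) / α * (1 * α * (r - c) ^ (α - 1))) ?_ ?_ ?_
    · refine ((h.1.mono fun t ht => ⟨hc.trans_le ht.1, ht.2.trans hz⟩).const_mul _).add ?_
      refine ContinuousOn.const_mul ?_ _
      exact ContinuousOn.rpow_const (by fun_prop) fun _ _ => Or.inr hα0.le
    · intro r hr
      rw [interior_Icc] at hr
      refine (((h.2.1 r ⟨hc.trans hr.1, hr.2.trans_le hz⟩).const_mul _).add
        (HasDerivAt.const_mul _ ?_)).hasDerivWithinAt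
      exact ((hasDerivAt_id r).sub_const c).rpow_const (Or.inl (sub_pos.2 hr.1).ne')
    · intro r hr
      rw [interior_Icc] at hr
      have h1 : |u c * u' r| ≤ m * (m * ((1 + K) * (r - c) ^ (α - 1))) := by
        rw [abs_mul]
        gcongr
        exact hder r hr
      have h2 : m ^ 2 * (1 + K) / α * (1 * α * (r - c) ^ (α - 1)) =
          m * (m * ((1 + K) * (r - c) ^ (α - 1))) := by
        field_simp
      rw [h2]
      linarith [neg_abs_le (u c * u' r)]
  have h1 := hmono (left_mem_Icc.2 hcz.le) (right_mem_Icc.2 hcz.le) hcz.le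
  simp only [sub_self, Real.zero_rpow hα0.ne', mul_zero, add_zero, huz, zero_add] at h1
  have h2 : u c * u c = m ^ 2 := by rw [hm, sq_abs]; ring
  rw [h2, div_mul_eq_mul_div, le_div_iff₀ hα0, mul_assoc] at h1
  exact le_of_mul_le_mul_left h1 (by positivity)

/-- For `N ≥ 2`, `p > N/2`, `M > 0` there is `ε = ε(N,p,M) > 0` such that for
every radial `a ∈ L^p(B_1)` with `‖a‖_{L^p(B_1)} ≤ M` and every nontrivial radial `H^1`
solution `u` of `Δu + a u = 0` in `B_1`, any two distinct zeros `z₁, z₂ ∈ (0,1]` of `u`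
satisfy `|z₂ - z₁| > ε`. -/
theorem stmt15 (N : ℕ) (hN : 2 ≤ N) (p M : ℝ) (hp : (N : ℝ) / 2 < p) (hM : 0 < M) :
    ∃ ε : ℝ, 0 < ε ∧
      ∀ a : ℝ → ℝ, Measurable a → RadialMemLp N p a → radialLpNorm N p a ≤ M →
        ∀ u u' : ℝ → ℝ, IsRadialH1Solution N a u u' → (∃ r ∈ Ioc (0:ℝ) 1, u r ≠ 0) →
          ∀ z₁ ∈ Ioc (0:ℝ) 1, ∀ z₂ ∈ Ioc (0:ℝ) 1,
            u z₁ = 0 → u z₂ = 0 → z₁ ≠ z₂ → ε < |z₂ - z₁| := by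
  have hN0 : 0 < N := by omega
  have hp1 : 1 < p := by
    have : (2:ℝ) ≤ N := by exact_mod_cast hN
    linarith
  have hp0 : 0 < p := by linarith
  set α := 2 - (N : ℝ) / p with hα
  have hα0 : 0 < α := by
    rw [hα, sub_pos, div_lt_iff₀ hp0]
    linarith
  set K := M ^ p / omegaN N with hKdef
  have hK0 : 0 ≤ K := div_nonneg (by positivity) (omegaN_pos hN0).le
  set ε := (α / (2 * (1 + K))) ^ (1 / α) with hε
  have hε0 : 0 < ε := by positivity
  have hεα : ε ^ α = α / (2 * (1 + K)) := by
    rw [hε, ← Real.rpow_mul (by positivity), one_div_mul_cancel hα0.ne', Real.rpow_one]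
  refine ⟨ε, hε0, fun a ha hap haM u u' h hne => ?_⟩
  have hK := integral_rpow_le_of_radialLpNorm_le hN0 hp0 haM
  suffices H : ∀ x ∈ Ioc (0:ℝ) 1, ∀ y ∈ Ioc (0:ℝ) 1, u x = 0 → u y = 0 → x < y → ε < y - x by
    intro z₁ h₁ z₂ h₂ hu₁ hu₂ hz
    rcases hz.lt_or_gt with hlt | hlt
    · exact (H z₁ h₁ z₂ h₂ hu₁ hu₂ hlt).trans_le (le_abs_self _)
    · rw [abs_sub_comm]
      exact (H z₂ h₂ z₁ h₁ hu₂ hu₁ hlt).trans_le (le_abs_self _)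
  intro x hx y hy hux huy hxy
  have hcont : ContinuousOn (fun t => |u t|) (Icc x y) :=
    (h.1.mono fun t ht => ⟨hx.1.trans_le ht.1, ht.2.trans hy.2⟩).abs
  obtain ⟨c₀, hc₀, hmax₀⟩ := isCompact_Icc.exists_isMaxOn ⟨x, left_mem_Icc.2 hxy.le⟩ hcont
  obtain ⟨c, hc, huc, hmax⟩ : ∃ c ∈ Ioo x y, u c ≠ 0 ∧ ∀ t ∈ Icc x y, |u t| ≤ |u c| := by
    by_cases hz : u c₀ = 0
    · exfalso
      have hzero : ∀ t ∈ Icc x y, u t = 0 := fun t ht => by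
        have h1 : |u t| ≤ |u c₀| := hmax₀ ht
        rw [hz, abs_zero] at h1
        exact abs_nonpos_iff.1 h1
      obtain ⟨d, hd⟩ := exists_between hxy
      have hd01 : d ∈ Ioo (0:ℝ) 1 := ⟨hx.1.trans hd.1, hd.2.trans_le hy.2⟩
      have hud' : u' d = 0 := by
        refine (h.2.1 d hd01).unique ((hasDerivAt_const d (0:ℝ)).congr_of_eventuallyEq ?_)
        filter_upwards [Icc_mem_nhds hd.1 hd.2] with t ht using hzero t ht
      obtain ⟨r, hr, hur⟩ := hne
      exact hur (h.eq_zero_of_cauchy_zero (hap.integrableOn_mul_abs hp1 ha) hd01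
        (hzero d ⟨hd.1.le, hd.2.le⟩) hud' r hr)
    · refine ⟨c₀, ⟨lt_of_le_of_ne hc₀.1 ?_, lt_of_le_of_ne hc₀.2 ?_⟩, hz, fun t ht => hmax₀ ht⟩
      · rintro rfl
        exact hz hux
      · rintro rfl
        exact hz huy
  have hc0 : 0 < c := hx.1.trans hc.1
  have huc' : u' c = 0 := by
    have hd := h.2.1 c ⟨hc0, hc.2.trans_le hy.2⟩
    have hloc : IsLocalMax (fun t => u t * u t) c := by
      filter_upwards [Icc_mem_nhds hc.1 hc.2] with t ht
      exact abs_le_iff_mul_self_le.1 (hmax t ht)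
    have h0 := hloc.hasDerivAt_eq_zero (hd.mul hd)
    have h1 : u c * u' c = 0 := by linarith
    exact (mul_eq_zero.1 h1).resolve_left huc
  have key := h.le_mul_rpow_of_critical hN0 hp1 hp ha hap hK hc0 hc.2 hy.2 huc huc' huy
    (fun t ht => hmax t ⟨hc.1.le.trans ht.1, ht.2⟩)
  by_contra! hle
  have hpow : (y - c) ^ α ≤ ε ^ α :=
    Real.rpow_le_rpow (sub_pos.2 hc.2).le (by linarith [hc.1]) hα0.le
  have h1 : α ≤ (1 + K) * (α / (2 * (1 + K))) := by
    rw [← hεα]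
    exact key.trans (by gcongr)
  have h2 : (1 + K) * (α / (2 * (1 + K))) = α / 2 := by
    field_simp
  linarith
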